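/- arXiv:1404.3120 — 2 statements merged into one kernel-verified Lean document; each statement's English description precedes it below -/
import Mathlib

section
/- Landau–Toeplitz Theorem for slice regular functions (equality part): Let f(q) = ∑_{n≥0} q^n a_n be a slice regular function on 𝔹 such that d̃₂(f(𝔹)) = 2. Then the following are equivalent: (i) there exists r ∈ (0,1) with d̃₂(f(r𝔹)) = 2r, or |a₁| = 1; (ii) f is an affine function f(q) = a + qb with a, b ∈ ℍ and |b| = 1, i.e. a₀ = a, a₁ = b with |b| = 1, and a_n = 0 for all n ≥ 2. -/
noncomputable section

open Filter Metric Set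

local notation "ℍ" => Quaternion ℝ

/-- The regular composition `f_u(q) = ∑ q^n u^n a_n` of `f(q) = ∑ q^n a_n` with `q ↦ qu`. -/
def regComp (a : ℕ → ℍ) (u q : ℍ) : ℍ := ∑' n : ℕ, q ^ n * u ^ n * a n

/-- The regular diameter `d̃₂(f(r𝔹)) = max_{u,v ∈ 𝔹̄} max_{|q| ≤ r} |f_u(q) - f_v(q)|`. -/
def regDiam2 (a : ℕ → ℍ) (r : ℝ) : ℝ :=
  sSup {x : ℝ | ∃ u v q : ℍ, ‖u‖ ≤ 1 ∧ ‖v‖ ≤ 1 ∧ ‖q‖ ≤ r ∧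
    x = ‖regComp a u q - regComp a v q‖}

/-! ### Complex power series on the unit disc -/

lemma LT_fps (c : ℕ → ℂ)
    (hc : ∀ ρ : ℝ, 0 ≤ ρ → ρ < 1 → Summable fun n : ℕ => ‖c n‖ * ρ ^ n) :
    HasFPowerSeriesOnBall (fun z => ∑' n, c n * z ^ n) (FormalMultilinearSeries.ofScalars ℂ c) 0 1 := by
  refine ⟨?_, by norm_num, ?_⟩
  · refine le_of_forall_lt_imp_le_of_dense (fun ρ hρ => ?_)
    lift ρ to NNReal using (hρ.trans ENNReal.one_lt_top).ne
    refine FormalMultilinearSeries.le_radius_of_summable_norm _ ?_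
    have := hc ρ ρ.2 (by exact_mod_cast hρ)
    refine this.of_nonneg_of_le (fun n => by positivity) (fun n => ?_)
    rw [FormalMultilinearSeries.ofScalars_norm]
  · intro y hy
    have hy' : ‖y‖ < 1 := by
      rw [← ENNReal.ofReal_one, Metric.eball_ofReal] at hy
      simpa using hy
    have hs : Summable fun n => c n * y ^ n := by
      refine Summable.of_norm ?_
      simpa [norm_mul, norm_pow] using hc ‖y‖ (norm_nonneg _) hy'
    simpa [FormalMultilinearSeries.ofScalars_apply_eq, smul_eq_mul, mul_comm] using hs.hasSum

lemma LT_diff (c : ℕ → ℂ)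
    (hc : ∀ ρ : ℝ, 0 ≤ ρ → ρ < 1 → Summable fun n : ℕ => ‖c n‖ * ρ ^ n) :
    DifferentiableOn ℂ (fun z => ∑' n, c n * z ^ n) (ball 0 1) := by
  have := (LT_fps c hc).differentiableOn
  refine this.mono ?_
  intro z hz
  rw [← ENNReal.ofReal_one, Metric.eball_ofReal]
  exact hz

lemma LT_deriv (c : ℕ → ℂ)
    (hc : ∀ ρ : ℝ, 0 ≤ ρ → ρ < 1 → Summable fun n : ℕ => ‖c n‖ * ρ ^ n) :
    deriv (fun z => ∑' n, c n * z ^ n) 0 = c 1 := by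
  have := (LT_fps c hc).hasFPowerSeriesAt.deriv
  simpa [FormalMultilinearSeries.ofScalars_apply_eq] using this

lemma LT_cauchy (c : ℕ → ℂ)
    (hc : ∀ ρ : ℝ, 0 ≤ ρ → ρ < 1 → Summable fun n : ℕ => ‖c n‖ * ρ ^ n)
    (B : ℝ) (hB : ∀ z : ℂ, ‖z‖ = 1 / 2 → ‖∑' n, c n * z ^ n‖ ≤ B) (n : ℕ) :
    ‖c n‖ ≤ B * 2 ^ n := by
  set P : ℂ → ℂ := fun z => ∑' n, c n * z ^ n with hP
  have hd : DifferentiableOn ℂ P (closedBall 0 ((1 / 2 : NNReal) : ℝ)) := by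
    refine (LT_diff c hc).mono (closedBall_subset_ball ?_)
    norm_num
  have h1 := hd.hasFPowerSeriesOnBall (by norm_num)
  have h2 := (LT_fps c hc).hasFPowerSeriesAt.eq_formalMultilinearSeries h1.hasFPowerSeriesAt
  have h3 : ‖FormalMultilinearSeries.ofScalars ℂ c n‖ = ‖c n‖ := by
    rw [FormalMultilinearSeries.ofScalars_norm]
  rw [← h3, h2]
  refine (norm_cauchyPowerSeries_le P 0 _ n).trans ?_
  have h4 : (2 * Real.pi)⁻¹ * ∫ θ in (0:ℝ)..2 * Real.pi, ‖P (circleMap 0 ((1 / 2 : NNReal) : ℝ) θ)‖ ≤ B := by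
    have h5 := intervalIntegral.norm_integral_le_of_norm_le_const (a := 0) (b := 2 * Real.pi)
      (f := fun θ => ‖P (circleMap 0 ((1 / 2 : NNReal) : ℝ) θ)‖) (C := B) (fun θ _ => by
        rw [norm_norm]
        exact hB _ (by simp))
    have h6 := (le_abs_self _).trans h5
    have hp := Real.pi_pos
    rw [sub_zero, abs_of_pos (by positivity)] at h6
    rw [inv_mul_le_iff₀ (by positivity)]
    linarith
  have h7 : (|((1 / 2 : NNReal) : ℝ)|⁻¹ ^ n) = (2:ℝ) ^ n := by
    norm_num
  rw [h7]
  gcongr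

lemma LT_shift_summable (c : ℕ → ℂ)
    (hc : ∀ ρ : ℝ, 0 ≤ ρ → ρ < 1 → Summable fun n : ℕ => ‖c n‖ * ρ ^ n) :
    ∀ ρ : ℝ, 0 ≤ ρ → ρ < 1 → Summable fun n : ℕ => ‖c (n+1)‖ * ρ ^ n := by
  intro ρ h0 h1
  rcases h0.eq_or_lt with rfl | h0
  · refine summable_of_ne_finset_zero (s := {0}) ?_
    intro b hb
    have : b ≠ 0 := by simpa using hb
    simp [this]
  · have := ((summable_nat_add_iff 1).2 (hc ρ h0.le h1)).mul_left ρ⁻¹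
    refine this.congr (fun n => ?_)
    field_simp
    ring

lemma LT_shift (c : ℕ → ℂ) (h0 : c 0 = 0)
    (hc : ∀ ρ : ℝ, 0 ≤ ρ → ρ < 1 → Summable fun n : ℕ => ‖c n‖ * ρ ^ n) (z : ℂ) (hz : ‖z‖ < 1) :
    ∑' n, c n * z ^ n = z * ∑' n, c (n+1) * z ^ n := by
  have hs : Summable fun n => c n * z ^ n := by
    refine Summable.of_norm ?_
    simpa [norm_mul, norm_pow] using hc ‖z‖ (norm_nonneg _) hz
  rw [hs.tsum_eq_zero_add, ← tsum_mul_left]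
  simp only [h0, zero_mul, zero_add]
  congr 1; ext n; ring

/-- Schwarz bound for the first coefficient. -/
lemma LT_coef_one (c : ℕ → ℂ) (h0 : c 0 = 0)
    (hc : ∀ ρ : ℝ, 0 ≤ ρ → ρ < 1 → Summable fun n : ℕ => ‖c n‖ * ρ ^ n) (M : ℝ)
    (hM : ∀ z : ℂ, ‖z‖ < 1 → ‖∑' n, c n * z ^ n‖ ≤ M) : ‖c 1‖ ≤ M := by
  have hP0 : (∑' n, c n * (0:ℂ) ^ n) = 0 := by rw [LT_shift c h0 hc 0 (by simp)]; simp
  have := Complex.norm_deriv_le_div_of_mapsTo_ball (LT_diff c hc) (R₂ := M) (by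
    intro z hz
    simp only [hP0]
    simpa using hM z (by simpa using hz)) one_pos
  rwa [LT_deriv c hc, div_one] at this

/-- Equality in the Schwarz lemma. -/
lemma LT_coef_eq (c : ℕ → ℂ) (h0 : c 0 = 0)
    (hc : ∀ ρ : ℝ, 0 ≤ ρ → ρ < 1 → Summable fun n : ℕ => ‖c n‖ * ρ ^ n) (M : ℝ)
    (hM : ∀ z : ℂ, ‖z‖ < 1 → ‖∑' n, c n * z ^ n‖ ≤ M) (z₀ : ℂ) (hz₀ : ‖z₀‖ < 1) (hz1 : z₀ ≠ 0)
    (h : M * ‖z₀‖ ≤ ‖∑' n, c n * z₀ ^ n‖) : ‖c 1‖ = M := by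
  have hP0 : (∑' n, c n * (0:ℂ) ^ n) = 0 := by rw [LT_shift c h0 hc 0 (by simp)]; simp
  have hm : MapsTo (fun z => ∑' n, c n * z ^ n) (ball 0 1)
      (closedBall ((fun z => ∑' n, c n * z ^ n) 0) M) := by
    intro z hz
    simp only [hP0]
    simpa using hM z (by simpa using hz)
  have hz : z₀ ∈ ball (0:ℂ) 1 := by simpa using hz₀
  have hle := Complex.norm_dslope_le_div_of_mapsTo_ball (LT_diff c hc) hm hz
  have hds : ‖dslope (fun z => ∑' n, c n * z ^ n) 0 z₀‖ = M / 1 := by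
    refine le_antisymm hle ?_
    rw [dslope_of_ne _ hz1, slope_def_module, hP0]
    have : 0 < ‖z₀‖ := norm_pos_iff.2 hz1
    simp only [sub_zero, norm_smul, norm_inv, div_one]
    rw [le_inv_mul_iff₀ this]
    linarith
  have heq := Complex.affine_of_mapsTo_ball_of_norm_dslope_eq_div (LT_diff c hc) hm hz hds
  have hev := heq.eventuallyEq_of_mem (ball_mem_nhds (0:ℂ) one_pos)
  have hd := hev.deriv_eq
  rw [LT_deriv c hc] at hd
  rw [hd, ← div_one M, ← hds]
  congr 1
  simp

/-- Carathéodory type coefficient bound. -/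
lemma LT_carath (c : ℕ → ℂ) (h0 : c 0 = 0)
    (hc : ∀ ρ : ℝ, 0 ≤ ρ → ρ < 1 → Summable fun n : ℕ => ‖c n‖ * ρ ^ n) (M δ : ℝ) (hδ : 0 < δ)
    (hM : ∀ z : ℂ, ‖z‖ < 1 → ‖∑' n, c n * z ^ n‖ ≤ M) (h1 : M - (c 1).re ≤ δ) (n : ℕ)
    (hn : 2 ≤ n) : ‖c n‖ ≤ 2 * δ * 2 ^ n := by
  have hs := LT_shift_summable c hc
  set Q : ℂ → ℂ := fun z => ∑' n, c (n+1) * z ^ n with hQ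
  have hQd : DifferentiableOn ℂ Q (ball 0 1) := LT_diff _ hs
  have hQ0 : Q 0 = c 1 := by
    simp only [hQ]
    rw [tsum_eq_single 0]
    · simp
    · intro b hb; simp [hb]
  have hP0 : (∑' n, c n * (0:ℂ) ^ n) = 0 := by rw [LT_shift c h0 hc 0 (by simp)]; simp
  have hm : MapsTo (fun z => ∑' n, c n * z ^ n) (ball 0 1)
      (closedBall ((fun z => ∑' n, c n * z ^ n) 0) M) := by
    intro z hz
    simp only [hP0]
    simpa using hM z (by simpa using hz)
  have hre : ∀ z : ℂ, ‖z‖ < 1 → (Q z).re ≤ M := by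
    intro z hz
    refine (Complex.re_le_norm _).trans ?_
    rcases eq_or_ne z 0 with rfl | hz0
    · rw [hQ0]; exact LT_coef_one c h0 hc M hM
    · have := Complex.dist_le_div_mul_dist_of_mapsTo_ball (LT_diff c hc) hm (z := z)
        (by simpa using hz)
      simp only [hP0, dist_zero_right, div_one] at this
      rw [LT_shift c h0 hc z hz, norm_mul, mul_comm] at this
      exact le_of_mul_le_mul_right this (norm_pos_iff.2 hz0)
  have hbc : ∀ z : ℂ, ‖z‖ = 1 / 2 → ‖Q z - c 1‖ ≤ 2 * δ := by
    intro z hz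
    have := Complex.borelCaratheodory_zero (f := fun z => Q z - c 1) (M := δ) (R := 1) (z := z) hδ
      (hQd.sub_const _) (by
        intro w hw
        have := hre w (by simpa using hw)
        simp only [mem_ofPred_eq, Complex.sub_re]
        linarith) one_pos (by simp [hz]; norm_num) (by simp [hQ0])
    rw [hz] at this
    refine this.trans (le_of_eq ?_)
    norm_num
  obtain ⟨m, rfl⟩ : ∃ m, n = m + 2 := ⟨n - 2, by omega⟩
  have hs2 : ∀ ρ : ℝ, 0 ≤ ρ → ρ < 1 →
      Summable fun n : ℕ => ‖(if n = 0 then 0 else c (n+1))‖ * ρ ^ n := by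
    intro ρ h0 h1
    refine (hs ρ h0 h1).of_nonneg_of_le (fun n => by positivity) (fun n => ?_)
    gcongr
    split_ifs <;> simp
  have hfin := LT_cauchy (fun n => if n = 0 then 0 else c (n+1)) hs2 (2 * δ) (by
    intro z hz
    have hz1 : ‖z‖ < 1 := by rw [hz]; norm_num
    convert hbc z hz using 2
    have hsz : Summable fun n => c (n+1) * z ^ n := by
      refine Summable.of_norm ?_
      simpa [norm_mul, norm_pow] using hs ‖z‖ (norm_nonneg _) hz1
    have hsz' : Summable fun n => (if n = 0 then 0 else c (n+1)) * z ^ n := by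
      refine Summable.of_norm ?_
      simpa only [norm_mul, norm_pow] using hs2 ‖z‖ (norm_nonneg _) hz1
    simp only [hQ]
    rw [hsz.tsum_eq_zero_add, hsz'.tsum_eq_zero_add]
    simp) (m+1)
  simp only [Nat.add_eq_zero_iff, one_ne_zero, and_false, if_false] at hfin
  refine hfin.trans ?_
  gcongr <;> norm_num

/-! ### Slices -/

/-- The embedding of `ℂ` as the slice generated by `I`. -/
def LTphi (I : ℍ) (hI : I * I = -1) : ℂ →ₐ[ℝ] ℍ := Complex.lift ⟨I, hI⟩

lemma LTphi_apply (I : ℍ) (hI : I * I = -1) (z : ℂ) :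
    LTphi I hI z = (z.re : ℍ) + z.im • I := by
  simp [LTphi, Complex.lift]

lemma LT_I_normSq (I : ℍ) (hI : I * I = -1) (hre : I.re = 0) :
    I.imI ^ 2 + I.imJ ^ 2 + I.imK ^ 2 = 1 := by
  have := congrArg (fun x : ℍ => x.re) hI
  simp only [Quaternion.re_mul, Quaternion.re_neg, Quaternion.re_one, hre] at this
  nlinarith

/-- Quaternion with given components. -/
def LTmk (x y z w : ℝ) : ℍ := ⟨x, y, z, w⟩

lemma LTmk_re (x y z w : ℝ) : (LTmk x y z w).re = x := rfl
lemma LTmk_imI (x y z w : ℝ) : (LTmk x y z w).imI = y := rfl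
lemma LTmk_imJ (x y z w : ℝ) : (LTmk x y z w).imJ = z := rfl
lemma LTmk_imK (x y z w : ℝ) : (LTmk x y z w).imK = w := rfl

lemma LTmk_sq (y z w : ℝ) (h : y ^ 2 + z ^ 2 + w ^ 2 = 1) :
    LTmk 0 y z w * LTmk 0 y z w = -1 := by
  apply Quaternion.ext
  · simp only [Quaternion.re_mul, Quaternion.re_neg, Quaternion.re_one, LTmk_re, LTmk_imI,
      LTmk_imJ, LTmk_imK]
    linarith
  · simp only [Quaternion.imI_mul, Quaternion.imI_neg, Quaternion.imI_one, LTmk_re, LTmk_imI,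
      LTmk_imJ, LTmk_imK]
    ring
  · simp only [Quaternion.imJ_mul, Quaternion.imJ_neg, Quaternion.imJ_one, LTmk_re, LTmk_imI,
      LTmk_imJ, LTmk_imK]
    ring
  · simp only [Quaternion.imK_mul, Quaternion.imK_neg, Quaternion.imK_one, LTmk_re, LTmk_imI,
      LTmk_imJ, LTmk_imK]
    ring

lemma LTphi_norm (I : ℍ) (hI : I * I = -1) (hre : I.re = 0) (z : ℂ) :
    ‖LTphi I hI z‖ = ‖z‖ := by
  have h := LT_I_normSq I hI hre
  have h1 : ‖LTphi I hI z‖ ^ 2 = ‖z‖ ^ 2 := by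
    rw [sq, ← Quaternion.normSq_eq_norm_mul_self, Quaternion.normSq_def', LTphi_apply,
      Complex.sq_norm, Complex.normSq_apply]
    simp [hre]
    linear_combination z.im ^ 2 * h
  exact (sq_eq_sq₀ (norm_nonneg _) (norm_nonneg _)).1 h1

lemma LT_exists_slice (q : ℍ) : ∃ (I : ℍ) (hI : I * I = -1), I.re = 0 ∧
    ∃ z : ℂ, LTphi I hI z = q := by
  set s : ℝ := q.imI ^ 2 + q.imJ ^ 2 + q.imK ^ 2 with hs
  by_cases h : s = 0
  · have h1 : q.imI = 0 := by nlinarith [sq_nonneg q.imI, sq_nonneg q.imJ, sq_nonneg q.imK]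
    have h2 : q.imJ = 0 := by nlinarith [sq_nonneg q.imI, sq_nonneg q.imJ, sq_nonneg q.imK]
    have h3 : q.imK = 0 := by nlinarith [sq_nonneg q.imI, sq_nonneg q.imJ, sq_nonneg q.imK]
    refine ⟨LTmk 0 1 0 0, LTmk_sq _ _ _ (by norm_num), rfl, ⟨q.re, 0⟩, ?_⟩
    rw [LTphi_apply]
    apply Quaternion.ext <;> simp [h1, h2, h3]
  · have hs0 : 0 ≤ s := by positivity
    have hsq : Real.sqrt s * Real.sqrt s = s := Real.mul_self_sqrt hs0
    have hne : Real.sqrt s ≠ 0 := by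
      intro hh; rw [hh] at hsq; exact h (by linarith)
    refine ⟨LTmk 0 (q.imI / Real.sqrt s) (q.imJ / Real.sqrt s) (q.imK / Real.sqrt s), ?_, rfl,
      ⟨q.re, Real.sqrt s⟩, ?_⟩
    · apply LTmk_sq
      rw [div_pow, div_pow, div_pow, ← add_div, ← add_div, sq (Real.sqrt s), hsq, ← hs,
        div_self h]
    · rw [LTphi_apply]
      apply Quaternion.ext <;> simp [LTmk_re, LTmk_imI, LTmk_imJ, LTmk_imK] <;> field_simp

/-- The complex-linear functional on `ℍ` (as a left vector space over the slice of `I`)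
whose real part is the inner product with `w`. -/
def LTK (I w : ℍ) : ℍ →L[ℝ] ℂ :=
  LinearMap.toContinuousLinearMap
    { toFun := fun x => ⟨(x * star w).re, -(I * x * star w).re⟩
      map_add' := by
        intro x y
        apply Complex.ext
        · simp only [add_mul, Quaternion.re_add, Complex.add_re]
        · simp only [mul_add, add_mul, Quaternion.re_add, Complex.add_im]; ring
      map_smul' := by
        intro r x
        apply Complex.ext
        · simp only [smul_mul_assoc, Quaternion.re_smul, RingHom.id_apply, Complex.smul_re]
        · simp only [smul_mul_assoc, mul_smul_comm, Quaternion.re_smul, RingHom.id_apply,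
            Complex.smul_im, smul_eq_mul]; ring }

lemma LTK_re (I w x : ℍ) : (LTK I w x).re = (x * star w).re := rfl

lemma LTK_im (I w x : ℍ) : (LTK I w x).im = -(I * x * star w).re := rfl

lemma LTK_phi (I : ℍ) (hI : I * I = -1) (w x : ℍ) (z : ℂ) :
    LTK I w (LTphi I hI z * x) = z * LTK I w x := by
  have e1 : LTphi I hI z * x = z.re • x + z.im • (I * x) := by
    rw [LTphi_apply, add_mul, smul_mul_assoc, Quaternion.coe_mul_eq_smul]
  have e2 : I * (I * x) = -x := by rw [← mul_assoc, hI]; simp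
  rw [e1, map_add, map_smul, map_smul]
  apply Complex.ext
  · simp only [Complex.add_re, Complex.smul_re, Complex.mul_re, LTK_re, LTK_im, smul_eq_mul]
    ring
  · simp only [Complex.add_im, Complex.smul_im, Complex.mul_im, LTK_re, LTK_im, smul_eq_mul, e2,
      neg_mul, Quaternion.re_neg]
    ring

lemma LTK_re_le (I w x : ℍ) : (LTK I w x).re ≤ ‖x‖ * ‖w‖ := by
  rw [LTK_re, ← Quaternion.inner_def]
  exact real_inner_le_norm x w

lemma LTK_norm_le (I : ℍ) (hI : I * I = -1) (hre : I.re = 0) (w x : ℍ) :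
    ‖LTK I w x‖ ≤ ‖x‖ * ‖w‖ := by
  set k := LTK I w x with hk
  by_cases h0 : k = 0
  · rw [h0]; simp; positivity
  have hkpos : 0 < ‖k‖ := norm_pos_iff.2 h0
  have h := LTK_re_le I w (LTphi I hI (starRingEnd ℂ k) * x)
  rw [LTK_phi, ← hk, norm_mul, LTphi_norm I hI hre, mul_comm, Complex.mul_conj,
    Complex.normSq_eq_norm_sq, RCLike.norm_conj, Complex.ofReal_re] at h
  nlinarith

lemma LTK_self (I w : ℍ) (hre : I.re = 0) : LTK I w w = ((‖w‖ ^ 2 : ℝ) : ℂ) := by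
  apply Complex.ext
  · rw [LTK_re, ← Quaternion.inner_def, real_inner_self_eq_norm_sq, Complex.ofReal_re]
  · rw [LTK_im, mul_assoc, Quaternion.self_mul_star]
    rw [Complex.ofReal_im, Quaternion.re_mul]
    simp [hre]

lemma LTK_zero (w x : ℍ) (hw : w ≠ 0)
    (h : ∀ (I : ℍ), I * I = -1 → I.re = 0 → LTK I w x = 0) : x = 0 := by
  have h1 := h (LTmk 0 1 0 0) (LTmk_sq _ _ _ (by norm_num)) rfl
  have h2 := h (LTmk 0 0 1 0) (LTmk_sq _ _ _ (by norm_num)) rfl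
  have h3 := h (LTmk 0 0 0 1) (LTmk_sq _ _ _ (by norm_num)) rfl
  have e0 := congrArg Complex.re h1
  have e1 := congrArg Complex.im h1
  have e2 := congrArg Complex.im h2
  have e3 := congrArg Complex.im h3
  rw [LTK_re] at e0
  rw [LTK_im, mul_assoc] at e1 e2 e3
  have : x * star w = 0 := by
    generalize x * star w = y at *
    simp only [Quaternion.re_mul, LTmk_re, LTmk_imI, LTmk_imJ, LTmk_imK, Complex.zero_im] at e1 e2 e3
    apply Quaternion.ext
    · exact e0
    · rw [Quaternion.imI_zero]; linarith
    · rw [Quaternion.imJ_zero]; linarith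
    · rw [Quaternion.imK_zero]; linarith
  rcases mul_eq_zero.1 this with h | h
  · exact h
  · exact absurd (star_eq_zero.1 h) hw

/-! ### The regular composition -/

lemma LT_term_norm (a : ℕ → ℍ) (u q : ℍ) (r : ℝ) (hu : ‖u‖ ≤ 1) (hq : ‖q‖ ≤ r) (n : ℕ) :
    ‖q ^ n * u ^ n * a n‖ ≤ ‖a n‖ * r ^ n := by
  rw [norm_mul, norm_mul, norm_pow, norm_pow]
  have h1 : ‖u‖ ^ n ≤ 1 := pow_le_one₀ (norm_nonneg _) hu
  have h2 : ‖q‖ ^ n ≤ r ^ n := pow_le_pow_left₀ (norm_nonneg _) hq n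
  calc ‖q‖ ^ n * ‖u‖ ^ n * ‖a n‖ ≤ r ^ n * 1 * ‖a n‖ := by
        have hr : 0 ≤ r := (norm_nonneg _).trans hq
        gcongr
    _ = _ := by ring

lemma LT_summable (a : ℕ → ℍ)
    (hconv : ∀ ρ : ℝ, 0 ≤ ρ → ρ < 1 → Summable fun n : ℕ => ‖a n‖ * ρ ^ n)
    (u q : ℍ) (hu : ‖u‖ ≤ 1) (hq : ‖q‖ < 1) :
    Summable fun n => q ^ n * u ^ n * a n :=
  Summable.of_norm_bounded (hconv ‖q‖ (norm_nonneg _) hq) (LT_term_norm a u q _ hu le_rfl)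

lemma LT_regComp_le (a : ℕ → ℍ)
    (hconv : ∀ ρ : ℝ, 0 ≤ ρ → ρ < 1 → Summable fun n : ℕ => ‖a n‖ * ρ ^ n)
    (u q : ℍ) (r : ℝ) (hr : r < 1) (hu : ‖u‖ ≤ 1) (hq : ‖q‖ ≤ r) :
    ‖regComp a u q‖ ≤ ∑' n, ‖a n‖ * r ^ n :=
  tsum_of_norm_bounded (hconv r ((norm_nonneg _).trans hq) hr).hasSum (LT_term_norm a u q r hu hq)

lemma LT_bdd (a : ℕ → ℍ)
    (hconv : ∀ ρ : ℝ, 0 ≤ ρ → ρ < 1 → Summable fun n : ℕ => ‖a n‖ * ρ ^ n)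
    (r : ℝ) (hr : r < 1) : BddAbove {x : ℝ | ∃ u v q : ℍ, ‖u‖ ≤ 1 ∧ ‖v‖ ≤ 1 ∧ ‖q‖ ≤ r ∧
    x = ‖regComp a u q - regComp a v q‖} := by
  refine ⟨2 * ∑' n, ‖a n‖ * r ^ n, ?_⟩
  rintro x ⟨u, v, q, hu, hv, hq, rfl⟩
  have h1 := LT_regComp_le a hconv u q r hr hu hq
  have h2 := LT_regComp_le a hconv v q r hr hv hq
  linarith [norm_sub_le (regComp a u q) (regComp a v q)]

lemma LT_le_two (a : ℕ → ℍ)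
    (hconv : ∀ ρ : ℝ, 0 ≤ ρ → ρ < 1 → Summable fun n : ℕ => ‖a n‖ * ρ ^ n)
    (hd2 : Tendsto (regDiam2 a) (nhdsWithin 1 (Set.Iio 1)) (nhds 2))
    (u v q : ℍ) (hu : ‖u‖ ≤ 1) (hv : ‖v‖ ≤ 1) (hq : ‖q‖ < 1) :
    ‖regComp a u q - regComp a v q‖ ≤ 2 := by
  refine ge_of_tendsto hd2 ?_
  have : Set.Ioo ‖q‖ 1 ∈ nhdsWithin 1 (Set.Iio 1) := Ioo_mem_nhdsLT hq
  filter_upwards [this] with r hr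
  exact le_csSup (LT_bdd a hconv r hr.2) ⟨u, v, q, hu, hv, hr.1.le, rfl⟩

lemma LT_continuousOn (a : ℕ → ℍ)
    (hconv : ∀ ρ : ℝ, 0 ≤ ρ → ρ < 1 → Summable fun n : ℕ => ‖a n‖ * ρ ^ n)
    (r : ℝ) (hr0 : 0 < r) (hr : r < 1) :
    ContinuousOn (fun p : ℍ × ℍ => regComp a p.1 p.2) (closedBall 0 1 ×ˢ closedBall 0 r) := by
  refine continuousOn_tsum (u := fun n => ‖a n‖ * r ^ n) (fun n => ?_) (hconv r hr0.le hr) ?_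
  · fun_prop
  · rintro n ⟨u, q⟩ ⟨hu, hq⟩
    exact LT_term_norm a u q r (by simpa using hu) (by simpa using hq) n

lemma LT_attained (a : ℕ → ℍ)
    (hconv : ∀ ρ : ℝ, 0 ≤ ρ → ρ < 1 → Summable fun n : ℕ => ‖a n‖ * ρ ^ n)
    (r : ℝ) (hr0 : 0 < r) (hr : r < 1) : ∃ u v q : ℍ, ‖u‖ ≤ 1 ∧ ‖v‖ ≤ 1 ∧ ‖q‖ ≤ r ∧
    regDiam2 a r = ‖regComp a u q - regComp a v q‖ := by
  have hc := LT_continuousOn a hconv r hr0 hr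
  set S : Set (ℍ × ℍ × ℍ) := closedBall 0 1 ×ˢ closedBall 0 1 ×ˢ closedBall 0 r with hS
  have hcomp : IsCompact S :=
    (isCompact_closedBall _ _).prod ((isCompact_closedBall _ _).prod (isCompact_closedBall _ _))
  have hne : S.Nonempty := ⟨(0, 0, 0), by simp [hS, hr0.le]⟩
  have hcont : ContinuousOn (fun p : ℍ × ℍ × ℍ => ‖regComp a p.1 p.2.2 - regComp a p.2.1 p.2.2‖)
      S := by
    refine ContinuousOn.norm (ContinuousOn.sub ?_ ?_)
    · exact hc.comp (f := fun p : ℍ × ℍ × ℍ => (p.1, p.2.2)) (by fun_prop)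
        (fun p hp => ⟨hp.1, hp.2.2⟩)
    · exact hc.comp (f := fun p : ℍ × ℍ × ℍ => (p.2.1, p.2.2)) (by fun_prop)
        (fun p hp => ⟨hp.2.1, hp.2.2⟩)
  obtain ⟨⟨u, v, q⟩, ⟨hu, hv, hq⟩, hmax⟩ := hcomp.exists_isMaxOn hne hcont
  have hu : ‖u‖ ≤ 1 := by simpa using hu
  have hv : ‖v‖ ≤ 1 := by simpa using hv
  have hq : ‖q‖ ≤ r := by simpa using hq
  refine ⟨u, v, q, hu, hv, hq, le_antisymm ?_ ?_⟩
  · refine csSup_le ⟨_, u, v, q, hu, hv, hq, rfl⟩ ?_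
    rintro x ⟨u₂, v₂, q₂, hu₂, hv₂, hq₂, rfl⟩
    exact hmax (a := (u₂, v₂, q₂)) (by simp [hS, hu₂, hv₂, hq₂])
  · exact le_csSup (LT_bdd a hconv r hr) ⟨u, v, q, hu, hv, hq, rfl⟩

lemma LT_coef_summable (a : ℕ → ℍ)
    (hconv : ∀ ρ : ℝ, 0 ≤ ρ → ρ < 1 → Summable fun n : ℕ => ‖a n‖ * ρ ^ n)
    (I : ℍ) (hI : I * I = -1) (hre : I.re = 0) (w u v : ℍ)
    (hu : ‖u‖ ≤ 1) (hv : ‖v‖ ≤ 1) (ρ : ℝ) (h0 : 0 ≤ ρ) (h1 : ρ < 1) :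
    Summable fun n : ℕ => ‖LTK I w ((u ^ n - v ^ n) * a n)‖ * ρ ^ n := by
  refine ((hconv ρ h0 h1).mul_left (2 * ‖w‖)).of_nonneg_of_le (fun n => by positivity) (fun n => ?_)
  have h := LTK_norm_le I hI hre w ((u ^ n - v ^ n) * a n)
  have h2 : ‖u ^ n - v ^ n‖ ≤ 2 := by
    have h3 : ‖u‖ ^ n ≤ 1 := pow_le_one₀ (norm_nonneg _) hu
    have h4 : ‖v‖ ^ n ≤ 1 := pow_le_one₀ (norm_nonneg _) hv
    have := norm_sub_le (u ^ n) (v ^ n)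
    rw [norm_pow, norm_pow] at this
    linarith
  rw [norm_mul] at h
  calc _ ≤ (2 * ‖a n‖ * ‖w‖) * ρ ^ n := by
        gcongr
        exact h.trans (by gcongr)
    _ = _ := by ring

lemma LT_link (a : ℕ → ℍ)
    (hconv : ∀ ρ : ℝ, 0 ≤ ρ → ρ < 1 → Summable fun n : ℕ => ‖a n‖ * ρ ^ n)
    (I : ℍ) (hI : I * I = -1) (hre : I.re = 0) (w u v : ℍ)
    (hu : ‖u‖ ≤ 1) (hv : ‖v‖ ≤ 1) (z : ℂ) (hz : ‖z‖ < 1) :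
    ∑' n : ℕ, LTK I w ((u ^ n - v ^ n) * a n) * z ^ n =
      LTK I w (regComp a u (LTphi I hI z) - regComp a v (LTphi I hI z)) := by
  have hq : ‖LTphi I hI z‖ < 1 := by rwa [LTphi_norm I hI hre]
  have hsu := (LT_summable a hconv u _ hu hq).hasSum
  have hsv := (LT_summable a hconv v _ hv hq).hasSum
  have h := ((hsu.sub hsv).mapL (LTK I w)).tsum_eq
  refine Eq.trans ?_ h
  congr 1; ext n
  rw [mul_assoc, mul_assoc, ← mul_sub, ← sub_mul, ← map_pow, LTK_phi, mul_comm]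

lemma LT_bound (a : ℕ → ℍ)
    (hconv : ∀ ρ : ℝ, 0 ≤ ρ → ρ < 1 → Summable fun n : ℕ => ‖a n‖ * ρ ^ n)
    (hd2 : Tendsto (regDiam2 a) (nhdsWithin 1 (Set.Iio 1)) (nhds 2))
    (I : ℍ) (hI : I * I = -1) (hre : I.re = 0) (w u v : ℍ)
    (hu : ‖u‖ ≤ 1) (hv : ‖v‖ ≤ 1) (z : ℂ) (hz : ‖z‖ < 1) :
    ‖∑' n : ℕ, LTK I w ((u ^ n - v ^ n) * a n) * z ^ n‖ ≤ 2 * ‖w‖ := by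
  have hq : ‖LTphi I hI z‖ < 1 := by rwa [LTphi_norm I hI hre]
  rw [LT_link a hconv I hI hre w u v hu hv z hz]
  refine (LTK_norm_le I hI hre _ _).trans ?_
  gcongr
  exact LT_le_two a hconv hd2 u v _ hu hv hq

lemma LT_a1_le (a : ℕ → ℍ)
    (hconv : ∀ ρ : ℝ, 0 ≤ ρ → ρ < 1 → Summable fun n : ℕ => ‖a n‖ * ρ ^ n)
    (hd2 : Tendsto (regDiam2 a) (nhdsWithin 1 (Set.Iio 1)) (nhds 2)) : ‖a 1‖ ≤ 1 := by
  obtain ⟨I, hI, hre, -⟩ := LT_exists_slice 0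
  have h := LT_coef_one (fun n => LTK I (a 1) (((1:ℍ) ^ n - (-1) ^ n) * a n)) (by simp)
    (LT_coef_summable a hconv I hI hre (a 1) 1 (-1) (by simp) (by simp)) _
    (LT_bound a hconv hd2 I hI hre (a 1) 1 (-1) (by simp) (by simp))
  have e : (((1:ℍ) ^ 1 - (-1) ^ 1) * a 1) = (2:ℝ) • a 1 := by
    rw [two_smul, pow_one, pow_one, sub_neg_eq_add, add_mul, one_mul]
  simp only [e, map_smul, LTK_self I (a 1) hre, norm_smul] at h
  rw [Complex.norm_real, Real.norm_eq_abs, Real.norm_eq_abs, abs_of_nonneg (by positivity),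
    abs_of_nonneg (by positivity)] at h
  nlinarith [norm_nonneg (a 1)]

lemma LT_a1_ge (a : ℕ → ℍ)
    (hconv : ∀ ρ : ℝ, 0 ≤ ρ → ρ < 1 → Summable fun n : ℕ => ‖a n‖ * ρ ^ n)
    (hd2 : Tendsto (regDiam2 a) (nhdsWithin 1 (Set.Iio 1)) (nhds 2))
    (r : ℝ) (hr0 : 0 < r) (hr1 : r < 1) (hr : regDiam2 a r = 2 * r) : 1 ≤ ‖a 1‖ := by
  obtain ⟨u, v, q, hu, hv, hq, hmax⟩ := LT_attained a hconv r hr0 hr1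
  obtain ⟨I, hI, hre, z, rfl⟩ := LT_exists_slice q
  set g := regComp a u (LTphi I hI z) - regComp a v (LTphi I hI z) with hg
  have hgn : ‖g‖ = 2 * r := by rw [← hmax, hr]
  rw [LTphi_norm I hI hre] at hq
  have hz1 : ‖z‖ < 1 := by linarith
  have hz0 : z ≠ 0 := by
    rintro rfl
    have h := LT_link a hconv I hI hre g u v hu hv 0 (by simp)
    rw [← hg, LTK_self I g hre, tsum_eq_single 0 (by intro b hb; simp [hb])] at h
    simp only [pow_zero, sub_self, zero_mul, map_zero] at h
    have h' : ‖g‖ ^ 2 = 0 := by exact_mod_cast h.symm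
    rw [hgn] at h'
    have : 0 < (2 * r) ^ 2 := by positivity
    linarith
  have h := LT_coef_eq (fun n => LTK I g ((u ^ n - v ^ n) * a n)) (by simp)
    (LT_coef_summable a hconv I hI hre g u v hu hv) _
    (LT_bound a hconv hd2 I hI hre g u v hu hv) z hz1 hz0 (by
      rw [LT_link a hconv I hI hre g u v hu hv z hz1, ← hg, LTK_self I g hre, Complex.norm_real,
        Real.norm_eq_abs, abs_of_nonneg (by positivity), hgn]
      nlinarith)
  have h2 := LTK_norm_le I hI hre g ((u ^ 1 - v ^ 1) * a 1)
  rw [h, norm_mul, hgn, pow_one, pow_one] at h2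
  have h3 : ‖u - v‖ ≤ 2 := (norm_sub_le _ _).trans (by linarith)
  have h4 : 2 ≤ ‖u - v‖ * ‖a 1‖ := le_of_mul_le_mul_right h2 (by positivity)
  nlinarith [norm_nonneg (a 1)]

/-- Lower bound for the multiplier. -/
lemma LT_mult (n : ℕ) (hn : 2 ≤ n) (t : ℝ) (ht0 : 0 < t) (ht : n * t ≤ 1) :
    t ≤ ‖(Complex.exp (-(t * Complex.I))) ^ n - (-Complex.exp (t * Complex.I)) ^ n‖ := by
  have hn' : (2:ℝ) ≤ n := by exact_mod_cast hn
  have e1 : (Complex.exp (-(t * Complex.I))) ^ n = Complex.exp (((-(n * t) : ℝ) : ℂ) * Complex.I) := by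
    rw [← Complex.exp_nat_mul]; congr 1; push_cast; ring
  have e2 : (Complex.exp (t * Complex.I)) ^ n = Complex.exp (((n * t : ℝ) : ℂ) * Complex.I) := by
    rw [← Complex.exp_nat_mul]; congr 1; push_cast; ring
  have hnt : 2 * t ≤ n * t := by gcongr
  rcases Nat.even_or_odd n with h | h
  · rw [h.neg_pow, e1, e2]
    refine le_trans ?_ (Complex.abs_im_le_norm _)
    rw [Complex.sub_im, Complex.exp_ofReal_mul_I_im, Complex.exp_ofReal_mul_I_im, Real.sin_neg]
    refine le_trans ?_ (neg_le_abs _)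
    have hp := Real.pi_gt_three
    have hp4 := Real.pi_le_four
    have := Real.mul_le_sin (x := n * t) (by positivity) (by linarith)
    have h2 : (1:ℝ) / 2 ≤ 2 / Real.pi := by
      rw [div_le_div_iff₀ (by norm_num) (by positivity)]; linarith
    nlinarith
  · rw [h.neg_pow, e1, e2]
    refine le_trans ?_ (Complex.abs_re_le_norm _)
    rw [Complex.sub_re, Complex.neg_re, Complex.exp_ofReal_mul_I_re, Complex.exp_ofReal_mul_I_re,
      Real.cos_neg]
    refine le_trans ?_ (le_abs_self _)
    have := Real.one_sub_sq_div_two_le_cos (x := n * t)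
    nlinarith

lemma LT_higher (a : ℕ → ℍ)
    (hconv : ∀ ρ : ℝ, 0 ≤ ρ → ρ < 1 → Summable fun n : ℕ => ‖a n‖ * ρ ^ n)
    (hd2 : Tendsto (regDiam2 a) (nhdsWithin 1 (Set.Iio 1)) (nhds 2)) (h1 : ‖a 1‖ = 1)
    (n : ℕ) (hn : 2 ≤ n) : a n = 0 := by
  refine LTK_zero (a 1) (a n) (by intro h; simp [h] at h1) (fun I hI hre => ?_)
  have hn' : (2:ℝ) ≤ n := by exact_mod_cast hn
  have key : ∀ t : ℝ, 0 < t → n * t ≤ 1 → ‖LTK I (a 1) (a n)‖ ≤ 2 * 2 ^ n * t := by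
    intro t ht0 ht
    set e₁ := Complex.exp (-(t * Complex.I)) with he1
    set e₂ := -Complex.exp (t * Complex.I) with he2
    have hn1 : ‖e₁‖ = 1 := by
      rw [he1, ← neg_mul, ← Complex.ofReal_neg]; exact Complex.norm_exp_ofReal_mul_I _
    have hn2 : ‖e₂‖ = 1 := by
      rw [he2, norm_neg]; exact Complex.norm_exp_ofReal_mul_I _
    have hu : ‖LTphi I hI e₁‖ ≤ 1 := by rw [LTphi_norm I hI hre, hn1]
    have hv : ‖LTphi I hI e₂‖ ≤ 1 := by rw [LTphi_norm I hI hre, hn2]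
    have hc : ∀ m, LTK I (a 1) (((LTphi I hI e₁) ^ m - (LTphi I hI e₂) ^ m) * a m) =
        (e₁ ^ m - e₂ ^ m) * LTK I (a 1) (a m) := by
      intro m
      rw [← map_pow, ← map_pow, ← map_sub, LTK_phi]
    have hnt : 2 * t ≤ n * t := by gcongr
    have hcos := Real.one_sub_sq_div_two_le_cos (x := t)
    have h := LT_carath (fun m => LTK I (a 1) (((LTphi I hI e₁) ^ m - (LTphi I hI e₂) ^ m) * a m))
      (by simp) (LT_coef_summable a hconv I hI hre (a 1) _ _ hu hv) _ (t ^ 2) (by positivity)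
      (LT_bound a hconv hd2 I hI hre (a 1) _ _ hu hv) (by
        simp only [hc]
        rw [LTK_self I _ hre, h1, pow_one, pow_one, he1, he2, ← neg_mul, ← Complex.ofReal_neg]
        rw [one_pow, Complex.ofReal_one, mul_one, mul_one, Complex.sub_re, Complex.neg_re,
          Complex.exp_ofReal_mul_I_re, Complex.exp_ofReal_mul_I_re, Real.cos_neg]
        linarith) n hn
    simp only [hc] at h
    rw [norm_mul] at h
    have hm := LT_mult n hn t ht0 ht
    have h3 : t * ‖LTK I (a 1) (a n)‖ ≤ t * (2 * 2 ^ n * t) := by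
      calc _ ≤ _ := mul_le_mul_of_nonneg_right hm (norm_nonneg _)
        _ ≤ _ := h
        _ = _ := by ring
    exact le_of_mul_le_mul_left h3 ht0
  rw [← norm_le_zero_iff]
  have ht : Tendsto (fun t : ℝ => 2 * 2 ^ n * t) (nhdsWithin 0 (Set.Ioi 0)) (nhds 0) := by
    have : Continuous fun t : ℝ => 2 * 2 ^ n * t := by fun_prop
    have := this.tendsto 0
    rw [mul_zero] at this
    exact this.mono_left nhdsWithin_le_nhds
  refine ge_of_tendsto ht ?_
  have : Set.Ioo (0:ℝ) (1 / n) ∈ nhdsWithin 0 (Set.Ioi 0) := Ioo_mem_nhdsGT (by positivity)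
  filter_upwards [this] with t ht
  refine key t ht.1 ?_
  have := ht.2.le
  rw [le_div_iff₀ (by positivity)] at this
  linarith

/-- Landau–Toeplitz theorem for slice regular functions, equality part. -/
theorem landau_toeplitz_eq (a : ℕ → ℍ)
    (hconv : ∀ ρ : ℝ, 0 ≤ ρ → ρ < 1 → Summable fun n : ℕ => ‖a n‖ * ρ ^ n)
    (hd2 : Tendsto (regDiam2 a) (nhdsWithin 1 (Set.Iio 1)) (nhds 2)) :
    ((∃ r ∈ Set.Ioo (0 : ℝ) 1, regDiam2 a r = 2 * r) ∨ ‖a 1‖ = 1) ↔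
      (‖a 1‖ = 1 ∧ ∀ n : ℕ, 2 ≤ n → a n = 0) := by
  constructor
  · intro h
    have h1 : ‖a 1‖ = 1 := by
      rcases h with ⟨r, hr, h⟩ | h
      · exact le_antisymm (LT_a1_le a hconv hd2) (LT_a1_ge a hconv hd2 r hr.1 hr.2 h)
      · exact h
    exact ⟨h1, LT_higher a hconv hd2 h1⟩
  · exact fun h => Or.inr h.1
end
end

section
/- Let f(q) = ∑_{n≥0} q^n a_n be a slice regular function on 𝔹. Then Diam(f(𝔹)) ≤ d̃₂(f(𝔹)) ≤ 2·Diam(f(𝔹)), where Diam(E) = sup_{p,q ∈ E} |p − q| (the inequalities are understood in the extended reals [0, ∞]). -/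
noncomputable section

open Filter Metric Set ENNReal

local notation "ℍ" => Quaternion ℝ

/-- The slice regular function `f(q) = ∑ q^n a_n`. -/
def fval (a : ℕ → ℍ) (q : ℍ) : ℍ := ∑' n : ℕ, q ^ n * a n

/-- The regular diameter of `f(𝔹)`, i.e. `lim_{r → 1⁻} d̃₂(f(r𝔹))`, as an extended real;
since `r ↦ d̃₂(f(r𝔹))` is increasing, the limit coincides with the supremum over `r ∈ (0,1)`. -/
def regDiam2Ball (a : ℕ → ℍ) : ℝ≥0∞ :=
  ⨆ r ∈ Set.Ioo (0 : ℝ) 1, ENNReal.ofReal (regDiam2 a r)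

lemma aux_polar (u : ℍ) : ∃ (J : ℍ) (x y : ℝ), J * J = -1 ∧ J.re = 0 ∧ ‖J‖ = 1 ∧
    u = (x : ℍ) + y • J := by
  have key : ∀ J : ℍ, J.re = 0 → ‖J‖ = 1 → J * J = -1 := by
    intro J h0 h1
    have h2 : star J = -J := Quaternion.star_eq_neg.2 h0
    have h3 := Quaternion.self_mul_star J
    rw [h2, Quaternion.normSq_eq_norm_mul_self, h1] at h3
    rw [mul_neg] at h3
    rw [← neg_neg (J * J), h3]; simp
  by_cases h : u.im = 0
  · obtain ⟨E, hE0, hn⟩ : ∃ E : ℍ, E.re = 0 ∧ ‖E‖ = 1 := by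
      obtain ⟨E, h0, h1, h2, h3⟩ : ∃ E : ℍ, E.re = 0 ∧ E.imI = 1 ∧ E.imJ = 0 ∧ E.imK = 0 :=
        ⟨⟨0, 1, 0, 0⟩, rfl, rfl, rfl, rfl⟩
      refine ⟨E, h0, ?_⟩
      have := Quaternion.normSq_eq_norm_mul_self E
      rw [Quaternion.normSq_def', h0, h1, h2, h3] at this
      nlinarith [norm_nonneg E]
    refine ⟨E, u.re, 0, key _ hE0 hn, hE0, hn, ?_⟩
    conv_lhs => rw [← Quaternion.re_add_im u, h]
    simp
  · have hn : ‖u.im‖ ≠ 0 := norm_ne_zero_iff.2 h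
    have a1 : (‖u.im‖⁻¹ • u.im).re = 0 := by simp
    have a2 : ‖(‖u.im‖⁻¹ • u.im)‖ = 1 := by
      rw [norm_smul, norm_inv, norm_norm, inv_mul_cancel₀ hn]
    refine ⟨‖u.im‖⁻¹ • u.im, u.re, ‖u.im‖, key _ a1 a2, a1, a2, ?_⟩
    rw [smul_smul, mul_inv_cancel₀ hn, one_smul, Quaternion.re_add_im]

lemma aux_norm (J : ℍ) (x y : ℝ) (h0 : J.re = 0) (h1 : ‖J‖ = 1) :
    ‖(x : ℍ) + y • J‖ ^ 2 = x ^ 2 + y ^ 2 := by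
  have h2 := Quaternion.normSq_eq_norm_mul_self J
  rw [h1, Quaternion.normSq_def', h0] at h2
  rw [sq, ← Quaternion.normSq_eq_norm_mul_self, Quaternion.normSq_def']
  simp [h0]
  linear_combination y ^ 2 * h2

lemma aux_pow (x y : ℝ) (n : ℕ) : ∃ c d : ℝ, ∀ J : ℍ, J * J = -1 →
    ((x : ℍ) + y • J) ^ n = (c : ℍ) + d • J := by
  induction n with
  | zero => exact ⟨1, 0, fun J _ => by simp⟩
  | succ n ih =>
    obtain ⟨c, d, h⟩ := ih
    refine ⟨c * x - d * y, c * y + d * x, fun J hJ => ?_⟩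
    rw [pow_succ, h J hJ]
    have e : ∀ t : ℝ, (t : ℍ) = t • (1 : ℍ) := fun t => by
      rw [← Quaternion.coe_mul_eq_smul, mul_one]
    rw [e c, e x, e]
    simp only [add_mul, mul_add, smul_mul_smul_comm, hJ, mul_one, one_mul]
    module

lemma aux_rep (x y : ℝ) (I J : ℍ) (hI : I * I = -1) (hJ : J * J = -1) (n : ℕ) :
    ((x : ℍ) + y • I) ^ n = (1 / 2 : ℝ) • (
      (((x : ℍ) + y • J) ^ n + ((x : ℍ) + (-y) • J) ^ n)
      - I * (J * (((x : ℍ) + y • J) ^ n - ((x : ℍ) + (-y) • J) ^ n))) := by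
  obtain ⟨c, d, h⟩ := aux_pow x y n
  have h' := h (-J) (by simpa using hJ)
  have e : (-y) • J = y • (-J) := by simp
  rw [e, h', h I hI, h J hJ]
  have e2 : J * ((c : ℍ) + d • J - ((c : ℍ) + d • -J)) = (-2 * d) • (1 : ℍ) := by
    have : (c : ℍ) + d • J - ((c : ℍ) + d • -J) = (2 * d) • J := by module
    rw [this, mul_smul_comm, hJ]; module
  rw [e2, mul_smul_comm, mul_one]
  module

lemma aux_summable (a : ℕ → ℍ)
    (hconv : ∀ ρ : ℝ, 0 ≤ ρ → ρ < 1 → Summable fun n : ℕ => ‖a n‖ * ρ ^ n)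
    (q : ℍ) (hq : ‖q‖ < 1) : Summable fun n : ℕ => q ^ n * a n := by
  refine Summable.of_norm ?_
  refine (hconv ‖q‖ (norm_nonneg _) hq).congr fun n => ?_
  rw [norm_mul, norm_pow, mul_comm]

lemma aux_regComp (a : ℕ → ℍ)
    (hconv : ∀ ρ : ℝ, 0 ≤ ρ → ρ < 1 → Summable fun n : ℕ => ‖a n‖ * ρ ^ n)
    (I : ℍ) (x y : ℝ) (hI : I * I = -1) (hxy : x ^ 2 + y ^ 2 < 1) (u : ℍ) (hu : ‖u‖ ≤ 1) :
    ∃ J p₁ p₂ : ℍ, ‖J‖ = 1 ∧ ‖p₁‖ < 1 ∧ ‖p₂‖ < 1 ∧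
      regComp a u ((x : ℍ) + y • I) =
        (1 / 2 : ℝ) • ((fval a p₁ + fval a p₂) - I * (J * (fval a p₁ - fval a p₂))) := by
  obtain ⟨J, s, t, hJ, hJ0, hJ1, rfl⟩ := aux_polar u
  have hlt : ∀ z : ℝ, z ^ 2 = y ^ 2 →
      ‖((x : ℍ) + z • J) * ((s : ℍ) + t • J)‖ < 1 := by
    intro z hz
    have h1 := aux_norm J x z hJ0 hJ1
    have h2 : ‖(x : ℍ) + z • J‖ < 1 := by
      nlinarith [norm_nonneg ((x : ℍ) + z • J)]
    rw [norm_mul]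
    exact lt_of_le_of_lt (mul_le_of_le_one_right (norm_nonneg _) hu) h2
  have hcomm : ∀ z : ℝ, Commute ((x : ℍ) + z • J) ((s : ℍ) + t • J) := by
    intro z
    have hc : ∀ (r : ℝ) (w : ℍ), Commute (r : ℍ) w := fun r w => Quaternion.coe_commutes r w
    refine ((hc _ _).add_left ?_)
    refine Commute.add_right (hc _ _).symm ?_
    exact ((Commute.refl J).smul_left z).smul_right t
  refine ⟨J, _, _, hJ1, hlt y rfl, hlt (-y) (by ring), ?_⟩
  have s1 := (aux_summable a hconv _ (hlt y rfl)).hasSum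
  have s2 := (aux_summable a hconv _ (hlt (-y) (by ring))).hasSum
  have s3 := ((s1.add s2).sub (((s1.sub s2).mul_left J).mul_left I)).const_smul (1 / 2 : ℝ)
  refine Eq.trans ?_ s3.tsum_eq
  refine tsum_congr fun n => ?_
  rw [aux_rep x y I J hI hJ n, (hcomm y).mul_pow, (hcomm (-y)).mul_pow]
  simp only [smul_mul_assoc, sub_mul, add_mul, mul_sub, mul_assoc]

lemma aux_bdd (a : ℕ → ℍ)
    (hconv : ∀ ρ : ℝ, 0 ≤ ρ → ρ < 1 → Summable fun n : ℕ => ‖a n‖ * ρ ^ n)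
    (r : ℝ) (hr0 : 0 ≤ r) (hr : r < 1) :
    BddAbove {x : ℝ | ∃ u v q : ℍ, ‖u‖ ≤ 1 ∧ ‖v‖ ≤ 1 ∧ ‖q‖ ≤ r ∧
      x = ‖regComp a u q - regComp a v q‖} := by
  have hb : ∀ u q : ℍ, ‖u‖ ≤ 1 → ‖q‖ ≤ r → ‖regComp a u q‖ ≤ ∑' n, ‖a n‖ * r ^ n := by
    intro u q hu hq
    refine tsum_of_norm_bounded (hconv r hr0 hr).hasSum fun n => ?_
    rw [norm_mul, norm_mul, norm_pow, norm_pow, mul_comm]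
    refine mul_le_mul_of_nonneg_left ?_ (norm_nonneg _)
    calc ‖q‖ ^ n * ‖u‖ ^ n ≤ ‖q‖ ^ n * 1 := by
          gcongr; exact pow_le_one₀ (norm_nonneg _) hu
      _ ≤ r ^ n := by rw [mul_one]; gcongr
  refine ⟨(∑' n, ‖a n‖ * r ^ n) + ∑' n, ‖a n‖ * r ^ n, ?_⟩
  · rintro _ ⟨u, v, q, hu, hv, hq, rfl⟩
    exact (norm_sub_le _ _).trans (add_le_add (hb u q hu hq) (hb v q hv hq))

lemma aux_real (a : ℕ → ℍ) (r : ℝ) (hr : 0 < r) (p : ℍ) :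
    regComp a (r⁻¹ • p) (r : ℍ) = fval a p := by
  refine tsum_congr fun n => ?_
  have hc : Commute (r : ℍ) (r⁻¹ • p) := Quaternion.coe_commutes r _
  rw [← hc.mul_pow, Quaternion.coe_mul_eq_smul, smul_smul, mul_inv_cancel₀ hr.ne', one_smul]

/-- `Diam(f(𝔹)) ≤ d̃₂(f(𝔹)) ≤ 2 Diam(f(𝔹))` in the extended reals. -/
theorem diam_le_regDiam2_le_two_diam (a : ℕ → ℍ)
    (hconv : ∀ ρ : ℝ, 0 ≤ ρ → ρ < 1 → Summable fun n : ℕ => ‖a n‖ * ρ ^ n) :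
    EMetric.diam (fval a '' Metric.ball 0 1) ≤ regDiam2Ball a ∧
      regDiam2Ball a ≤ 2 * EMetric.diam (fval a '' Metric.ball 0 1) := by
  constructor
  · refine Metric.ediam_le ?_
    rintro _ ⟨p, hp, rfl⟩ _ ⟨q, hq, rfl⟩
    rw [mem_ball_zero_iff] at hp hq
    obtain ⟨r, hr1, hr2⟩ := exists_between (max_lt hp hq)
    have hpr : ‖p‖ < r := (le_max_left _ _).trans_lt hr1
    have hqr : ‖q‖ < r := (le_max_right _ _).trans_lt hr1
    have hr0 : 0 < r := (norm_nonneg _).trans_lt hpr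
    have hn : ∀ w : ℍ, ‖w‖ < r → ‖r⁻¹ • w‖ ≤ 1 := by
      intro w hw
      rw [norm_smul, norm_inv, Real.norm_of_nonneg hr0.le, inv_mul_le_iff₀ hr0, mul_one]
      exact hw.le
    refine le_trans ?_ (le_iSup₂ (f := fun (r : ℝ) (_ : r ∈ Set.Ioo (0 : ℝ) 1) =>
      ENNReal.ofReal (regDiam2 a r)) r ⟨hr0, hr2⟩)
    rw [edist_dist, dist_eq_norm]
    refine ENNReal.ofReal_le_ofReal ?_
    refine le_csSup (aux_bdd a hconv r hr0.le hr2) ?_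
    refine ⟨r⁻¹ • p, r⁻¹ • q, (r : ℍ), hn p hpr, hn q hqr, ?_, ?_⟩
    · rw [Quaternion.norm_coe, Real.norm_of_nonneg hr0.le]
    · rw [aux_real a r hr0, aux_real a r hr0]
  · refine iSup₂_le fun r hr => ?_
    by_cases hD : EMetric.diam (fval a '' Metric.ball 0 1) = ⊤
    · rw [hD]; simp
    obtain ⟨D, hD'⟩ : ∃ D : NNReal, (D : ℝ≥0∞) = EMetric.diam (fval a '' Metric.ball 0 1) :=
      ⟨_, ENNReal.coe_toNNReal hD⟩
    have hdist : ∀ p q : ℍ, ‖p‖ < 1 → ‖q‖ < 1 → ‖fval a p - fval a q‖ ≤ (D : ℝ) := by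
      intro p q hp hq
      have h : edist (fval a p) (fval a q) ≤ D := by
        rw [hD']
        exact Metric.edist_le_ediam_of_mem ⟨p, by simpa using hp, rfl⟩ ⟨q, by simpa using hq, rfl⟩
      rw [← dist_eq_norm]
      rw [edist_nndist] at h
      exact_mod_cast h
    have hmain : regDiam2 a r ≤ 2 * (D : ℝ) := by
      refine Real.sSup_le ?_ (by positivity)
      rintro _ ⟨u, v, q, hu, hv, hq, rfl⟩
      obtain ⟨I, x, y, hI, hI0, hI1, rfl⟩ := aux_polar q
      have hxy : x ^ 2 + y ^ 2 < 1 := by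
        rw [← aux_norm I x y hI0 hI1]
        exact pow_lt_one₀ (norm_nonneg _) (hq.trans_lt hr.2) two_ne_zero
      obtain ⟨J, p₁, p₂, hJ, hp₁, hp₂, e1⟩ := aux_regComp a hconv I x y hI hxy u hu
      obtain ⟨K, q₁, q₂, hK, hq₁, hq₂, e2⟩ := aux_regComp a hconv I x y hI hxy v hv
      rw [e1, e2]
      have e3 : (1 / 2 : ℝ) • ((fval a p₁ + fval a p₂) - I * (J * (fval a p₁ - fval a p₂)))
          - (1 / 2 : ℝ) • ((fval a q₁ + fval a q₂) - I * (K * (fval a q₁ - fval a q₂)))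
          = (1 / 2 : ℝ) • ((fval a p₁ - fval a q₁) + (fval a p₂ - fval a q₂)
            - (I * (J * (fval a p₁ - fval a p₂)) - I * (K * (fval a q₁ - fval a q₂)))) := by
        module
      rw [e3, norm_smul]
      have n1 := hdist p₁ q₁ hp₁ hq₁
      have n2 := hdist p₂ q₂ hp₂ hq₂
      have n3 : ‖I * (J * (fval a p₁ - fval a p₂))‖ ≤ D := by
        rw [norm_mul, norm_mul, hI1, hJ, one_mul, one_mul]; exact hdist _ _ hp₁ hp₂
      have n4 : ‖I * (K * (fval a q₁ - fval a q₂))‖ ≤ D := by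
        rw [norm_mul, norm_mul, hI1, hK, one_mul, one_mul]; exact hdist _ _ hq₁ hq₂
      have m1 := norm_sub_le ((fval a p₁ - fval a q₁) + (fval a p₂ - fval a q₂))
        (I * (J * (fval a p₁ - fval a p₂)) - I * (K * (fval a q₁ - fval a q₂)))
      have m2 := norm_add_le (fval a p₁ - fval a q₁) (fval a p₂ - fval a q₂)
      have m3 := norm_sub_le (I * (J * (fval a p₁ - fval a p₂)))
        (I * (K * (fval a q₁ - fval a q₂)))
      rw [Real.norm_of_nonneg (by norm_num)]
      linarith
    rw [← hD']
    calc ENNReal.ofReal (regDiam2 a r) ≤ ENNReal.ofReal (2 * (D : ℝ)) :=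
          ENNReal.ofReal_le_ofReal hmain
      _ = 2 * (D : ℝ≥0∞) := by
          rw [ENNReal.ofReal_mul (by norm_num)]; simp
end
end
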